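/- In a structured semigroup (S, N, Z), if A, B ⊆ S are atlases with s(A) = r(B), then the equivalence relations respect products: for a, c ∈ A^< and b, d ∈ B^<, if a ~_A c and b ~_B d then ab ~_{AB} cd (the product AB being an atlas, so that ~_{AB} is defined on (AB)^<). -/

import Mathlib

open Pointwise

variable {S : Type*}

/-- `a <_s b`: the domination relation via `s`. -/
def domBy [Semigroup S] (N Z : Set S) (a s b : S) : Prop :=
  a * s * b = a ∧ b * s * a = a ∧ a * s ∈ N ∧ s * a ∈ N ∧ b * s ∈ Z ∧ s * b ∈ Z

/-- `a < b`: domination. -/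
def domRel [Semigroup S] (N Z : Set S) (a b : S) : Prop := ∃ s, domBy N Z a s b

/-- The up-closure `A^<`. -/
def upClo [Semigroup S] (N Z : Set S) (A : Set S) : Set S :=
  {b | ∃ a ∈ A, domRel N Z a b}

/-- The dual `A^*`. -/
def dualSet [Semigroup S] (N Z : Set S) (A : Set S) : Set S :=
  {s | ∃ a ∈ A, ∃ b, domBy N Z a s b}

/-- Structured semigroup data on `(S, N, Z)`. -/
structure Structured [Semigroup S] (N Z : Set S) : Prop where
  nMul : ∀ m ∈ N, ∀ n ∈ N, m * n ∈ N
  zMul : ∀ y ∈ Z, ∀ z ∈ Z, y * z ∈ Z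
  zSubN : Z ⊆ N
  zComm : ∀ z ∈ Z, ∀ n ∈ N, z * n = n * z
  binormal : ∀ a b : S, a * b ∈ Z → b * a ∈ Z → ∀ z ∈ Z, a * z * b ∈ Z ∧ b * z * a ∈ Z
  trinormal : ∀ a b : S, ∀ n ∈ N, a * b * n = n → n * a * b = n →
    a * b ∈ Z → b * a ∈ Z → b * n * a ∈ N

/-- An atlas: `A A^* A ⊆ A ⊆ A^<`. -/
def IsAtlas [Semigroup S] (N Z : Set S) (A : Set S) : Prop :=
  A * dualSet N Z A * A ⊆ A ∧ A ⊆ upClo N Z A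

/-- A coset: `A A^* A ⊆ A = A^<`. -/
def IsCoset [Semigroup S] (N Z : Set S) (A : Set S) : Prop :=
  A * dualSet N Z A * A ⊆ A ∧ upClo N Z A = A

/-- Source `s(A) = (A^* A)^<`. -/
def srcSet [Semigroup S] (N Z : Set S) (A : Set S) : Set S :=
  upClo N Z (dualSet N Z A * A)

/-- Range `r(A) = (A A^*)^<`. -/
def rngSet [Semigroup S] (N Z : Set S) (A : Set S) : Set S :=
  upClo N Z (A * dualSet N Z A)

/-- `A|b`: `b` acts on `A` from the right. -/
def actsR [Semigroup S] (Z : Set S) (A : Set S) (b : S) : Prop :=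
  ∃ b', b * b' ∈ Z ∧ b' * b ∈ Z ∧ ∃ a ∈ A, a * b * b' = a

/-- `b|A`: `b` acts on `A` from the left. -/
def actsL [Semigroup S] (Z : Set S) (b : S) (A : Set S) : Prop :=
  ∃ b', b * b' ∈ Z ∧ b' * b ∈ Z ∧ ∃ a ∈ A, b' * b * a = a

/-- `A^Z = {z ∈ Z : az = a for some a ∈ A}`. -/
def AZset [Semigroup S] (Z : Set S) (A : Set S) : Set S :=
  {z ∈ Z | ∃ a ∈ A, a * z = a}

/-- `^Z A = {z ∈ Z : za = a for some a ∈ A}`. -/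
def ZAset [Semigroup S] (Z : Set S) (A : Set S) : Set S :=
  {z ∈ Z | ∃ a ∈ A, z * a = a}

/-- The equivalence relation `a ~_A b`. -/
def eqvA [Semigroup S] (N Z : Set S) (A : Set S) (a b : S) : Prop :=
  ∃ s ∈ dualSet N Z A, ∃ t ∈ dualSet N Z A, s * a * t = s * b * t

/-- `Y` is symmetric: `ab ∈ Y → baba ∈ Y`. -/
def IsSymmetric [Semigroup S] (Y : Set S) : Prop :=
  ∀ a b : S, a * b ∈ Y → b * a * b * a ∈ Y

/-- `D` is diagonal: `ad, d, db ∈ D → adb ∈ D`. -/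
def IsDiagonal [Semigroup S] (D : Set S) : Prop :=
  ∀ a d b : S, a * d ∈ D → d ∈ D → d * b ∈ D → a * d * b ∈ D

section StructuredSemigroup

variable [Semigroup S] {N Z : Set S}

theorem domBy.mul (h : Structured N Z) {a s b c t d : S} (h₁ : domBy N Z a s b)
    (h₂ : domBy N Z c t d) : domBy N Z (a * c) (t * s) (b * d) := by
  obtain ⟨asb, bsa, as, sa, bs, sb⟩ := h₁
  obtain ⟨ctd, dtc, ct, tc, dt, td⟩ := h₂
  have comm₁ := h.zComm _ sb _ ct
  have comm₂ := h.zComm _ dt _ sa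
  have hn := h.nMul _ sa _ ct
  refine ⟨?_, ?_, ?_, ?_, ?_, ?_⟩
  · calc a * c * (t * s) * (b * d) = a * (c * t * (s * b)) * d := by simp only [mul_assoc]
      _ = (a * s * b) * (c * t * d) := by rw [← comm₁]; simp only [mul_assoc]
      _ = a * c := by rw [asb, ctd]
  · calc b * d * (t * s) * (a * c) = b * (d * t * (s * a)) * c := by simp only [mul_assoc]
      _ = (b * s * a) * (d * t * c) := by rw [comm₂]; simp only [mul_assoc]
      _ = a * c := by rw [bsa, dtc]
  · have key := h.trinormal s b (s * a * (c * t)) hn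
      (by calc s * b * (s * a * (c * t)) = s * (b * s * a) * (c * t) := by simp only [mul_assoc]
            _ = s * a * (c * t) := by rw [bsa])
      (by calc s * a * (c * t) * s * b = s * a * (c * t * (s * b)) := by simp only [mul_assoc]
            _ = s * (a * s * b) * (c * t) := by rw [← comm₁]; simp only [mul_assoc]
            _ = s * a * (c * t) := by rw [asb]) sb bs
    have : b * (s * a * (c * t)) * s = a * c * (t * s) := by
      calc b * (s * a * (c * t)) * s = b * s * a * (c * t * s) := by simp only [mul_assoc]
        _ = a * c * (t * s) := by rw [bsa]; simp only [mul_assoc]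
    rwa [this] at key
  · have key := h.trinormal d t (s * a * (c * t)) hn
      (by calc d * t * (s * a * (c * t)) = d * t * (s * a) * (c * t) := by simp only [mul_assoc]
            _ = s * a * (d * t * c) * t := by rw [comm₂]; simp only [mul_assoc]
            _ = s * a * (c * t) := by rw [dtc]; simp only [mul_assoc])
      (by calc s * a * (c * t) * d * t = s * a * ((c * t * d) * t) := by simp only [mul_assoc]
            _ = s * a * (c * t) := by rw [ctd]) dt td
    have : t * (s * a * (c * t)) * d = t * s * (a * c) := by
      calc t * (s * a * (c * t)) * d = t * s * a * (c * t * d) := by simp only [mul_assoc]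
        _ = t * s * (a * c) := by rw [ctd]; simp only [mul_assoc]
    rwa [this] at key
  · have := (h.binormal b s bs sb _ dt).1
    simpa only [mul_assoc] using this
  · have := (h.binormal d t dt td _ sb).2
    simpa only [mul_assoc] using this

theorem domBy.trans (h : Structured N Z) {a s b t c : S} (h₁ : domBy N Z a s b)
    (h₂ : domBy N Z b t c) : domBy N Z a t c := by
  obtain ⟨asb, bsa, as, sa, bs, sb⟩ := h₁
  obtain ⟨btc, ctb, bt, tb, ct, tc⟩ := h₂
  refine ⟨?_, ?_, ?_, ?_, ct, tc⟩
  · calc a * t * c = a * s * b * t * c := by rw [asb]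
      _ = a * s * (b * t * c) := by simp only [mul_assoc]
      _ = a := by rw [btc, asb]
  · calc c * t * a = c * t * (b * s * a) := by rw [bsa]
      _ = c * t * b * s * a := by simp only [mul_assoc]
      _ = a := by rw [ctb, bsa]
  · have : a * t = a * s * (b * t) := by rw [← mul_assoc, asb]
    rw [this]
    exact h.nMul _ as _ bt
  · have : t * a = t * b * (s * a) := by
      conv_lhs => rw [← bsa]
      simp only [mul_assoc]
    rw [this]
    exact h.nMul _ tb _ sa

theorem domBy.dual {a s b : S} (h₁ : domBy N Z a s b) : domBy N Z (s * a * s) b s := by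
  obtain ⟨asb, bsa, as, sa, bs, sb⟩ := h₁
  have e₁ : s * a * s * b = s * a := by rw [mul_assoc s, mul_assoc s, asb]
  have e₂ : b * (s * a * s) = a * s := by rw [← mul_assoc, ← mul_assoc, bsa]
  refine ⟨by rw [e₁], by rw [mul_assoc s b, e₂, mul_assoc], by rwa [e₁], by rwa [e₂], sb, bs⟩

theorem mem_dualSet_of_mem_upClo (h : Structured N Z) {A : Set S} {a s b : S}
    (ha : a ∈ upClo N Z A) (hd : domBy N Z a s b) : s ∈ dualSet N Z A := by
  obtain ⟨a₀, h₀, t, ht⟩ := ha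
  exact ⟨a₀, h₀, b, ht.trans h hd⟩

theorem mul_mem_of_closed {A : Set S} (hA : A * dualSet N Z A * A ⊆ A) {a s b : S} (ha : a ∈ A)
    (hs : s ∈ dualSet N Z A) (hb : b ∈ A) : a * s * b ∈ A :=
  hA (Set.mul_mem_mul (Set.mul_mem_mul ha hs) hb)

theorem dualSet_mul_upClo_mul_dualSet (h : Structured N Z) {A : Set S}
    (hA : A * dualSet N Z A * A ⊆ A) {s b t : S} (hs : s ∈ dualSet N Z A)
    (hb : b ∈ upClo N Z A) (ht : t ∈ dualSet N Z A) : s * b * t ∈ dualSet N Z A := by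
  obtain ⟨a, ha, a', has⟩ := hs
  obtain ⟨c, hc, c', hct⟩ := ht
  obtain ⟨b₀, hb₀, w, hw⟩ := hb
  have hw' : w ∈ dualSet N Z A := ⟨b₀, hb₀, b, hw⟩
  refine ⟨c * (w * b₀ * w * a), ?_, c' * (w * a'), ?_⟩
  · have := mul_mem_of_closed hA (mul_mem_of_closed hA hc hw' hb₀) hw' ha
    simpa only [mul_assoc] using this
  · exact hct.mul h (hw.dual.mul h has)

theorem upClo_mul_dualSet (h : Structured N Z) {B : Set S} (hB : IsAtlas N Z B) {b v : S}
    (hb : b ∈ upClo N Z B) (hv : v ∈ dualSet N Z B) : b * v ∈ rngSet N Z B := by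
  obtain ⟨b₀, hb₀, w, hw⟩ := hb
  obtain ⟨c, hc, c', hcv⟩ := id hv
  exact ⟨b₀ * (v * c * v),
    Set.mul_mem_mul hb₀ (dualSet_mul_upClo_mul_dualSet h hB.1 hv (hB.2 hc) hv), _,
    hw.mul h hcv.dual⟩

theorem upClo_mul_srcSet (h : Structured N Z) {A : Set S} (hA : A * dualSet N Z A * A ⊆ A)
    {a n : S} (ha : a ∈ upClo N Z A) (hn : n ∈ srcSet N Z A) : a * n ∈ upClo N Z A := by
  obtain ⟨a₀, ha₀, w, hw⟩ := ha
  obtain ⟨_, ⟨s, hs, a₁, ha₁, rfl⟩, v, hv⟩ := hn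
  refine ⟨a₀ * (s * a₁), ?_, _, hw.mul h hv⟩
  have := mul_mem_of_closed hA ha₀ hs ha₁
  rwa [mul_assoc] at this

theorem dualSet_mul_subset (h : Structured N Z) (A B : Set S) :
    dualSet N Z B * dualSet N Z A ⊆ dualSet N Z (A * B) := by
  rintro _ ⟨v, ⟨b, hb, b', hv⟩, s, ⟨a, ha, a', hs⟩, rfl⟩
  exact ⟨a * b, Set.mul_mem_mul ha hb, _, hs.mul h hv⟩

theorem dualSet_exists_upClo (A : Set S) {s : S} (hs : s ∈ dualSet N Z A) :
    ∃ e ∈ upClo N Z A, s * e ∈ Z ∧ e * s ∈ Z := by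
  obtain ⟨a, ha, e, he⟩ := hs
  exact ⟨e, ⟨a, ha, s, he⟩, he.2.2.2.2.2, he.2.2.2.2.1⟩

theorem upClo_exists_dualSet (A : Set S) {e : S} (he : e ∈ upClo N Z A) :
    ∃ s ∈ dualSet N Z A, s * e ∈ Z ∧ e * s ∈ Z := by
  obtain ⟨a, ha, s, hs⟩ := he
  exact ⟨s, ⟨a, ha, e, hs⟩, hs.2.2.2.2.2, hs.2.2.2.2.1⟩

theorem central_mul_sandwich (h : Structured N Z) {z t e : S} (hz : z ∈ Z) (hte : t * e ∈ Z) :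
    z * (t * e * t) = t * (e * z * t) := by
  rw [← mul_assoc, h.zComm _ hz _ (h.zSubN hte)]
  simp only [mul_assoc]

theorem sandwich_mul_central (h : Structured N Z) {z t e : S} (hz : z ∈ Z) (het : e * t ∈ Z) :
    t * e * t * z = t * z * e * t := by
  rw [mul_assoc t, mul_assoc t, ← h.zComm _ hz _ (h.zSubN het)]
  simp only [mul_assoc]

theorem sandwich_trans (h : Structured N Z) {D E : Set S}
    (hDED : ∀ s ∈ D, ∀ e ∈ E, ∀ t ∈ D, s * e * t ∈ D)
    (hE : ∀ s ∈ D, ∃ e ∈ E, s * e ∈ Z ∧ e * s ∈ Z) {x y z s t s' t' : S}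
    (hs : s ∈ D) (ht : t ∈ D) (hs' : s' ∈ D) (ht' : t' ∈ D)
    (hxy : s * x * t = s * y * t) (hyz : s' * y * t' = s' * z * t') :
    ∃ u ∈ D, ∃ v ∈ D, u * x * v = u * z * v := by
  obtain ⟨e, he, -, hes⟩ := hE s hs
  obtain ⟨e', he', -, hes'⟩ := hE s' hs'
  obtain ⟨f, hf, htf, -⟩ := hE t ht
  obtain ⟨f', hf', htf', -⟩ := hE t' ht'
  have key : ∀ w, s' * e' * s' * e * s * w * (t * f * (t' * f' * t')) =
      s' * (e * s) * e' * (s' * w * t') * (f' * (t * f) * t') := fun w => by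
    calc _ = (s' * e' * s' * (e * s)) * w * (t * f * (t' * f' * t')) := by
            simp only [mul_assoc]
      _ = _ := by
            rw [sandwich_mul_central h hes hes', central_mul_sandwich h htf htf']
            simp only [mul_assoc]
  refine ⟨_, hDED _ (hDED _ hs' _ he' _ hs') _ he _ hs,
    _, hDED _ ht _ hf _ (hDED _ ht' _ hf' _ ht'), ?_⟩
  calc _ = s' * e' * s' * e * (s * x * t) * (f * (t' * f' * t')) := by simp only [mul_assoc]
    _ = s' * e' * s' * e * s * y * (t * f * (t' * f' * t')) := by
          rw [hxy]; simp only [mul_assoc]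
    _ = _ := by rw [key, hyz, key]

end StructuredSemigroup

theorem stmt19 [Semigroup S] (N Z : Set S) (h : Structured N Z) (A B : Set S)
    (hA : IsAtlas N Z A) (hB : IsAtlas N Z B)
    (hsr : srcSet N Z A = rngSet N Z B)
    (a c : S) (ha : a ∈ upClo N Z A) (hc : c ∈ upClo N Z A)
    (b d : S) (hb : b ∈ upClo N Z B) (hd : d ∈ upClo N Z B)
    (h1 : eqvA N Z A a c) (h2 : eqvA N Z B b d) :
    eqvA N Z (A * B) (a * b) (c * d) := by
  obtain ⟨s₁, hs₁, t₁, ht₁, e₁⟩ := h1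
  obtain ⟨s₂, hs₂, t₂, ht₂, e₂⟩ := h2
  obtain ⟨q, hq, -, hbq⟩ := upClo_exists_dualSet B hb
  obtain ⟨r, hr, hrc, -⟩ := upClo_exists_dualSet A hc
  obtain ⟨a₂, ha₂, hta, -⟩ := dualSet_exists_upClo A ht₁
  obtain ⟨b₂, hb₂, -, hbs⟩ := dualSet_exists_upClo B hs₂
  have hp := dualSet_mul_upClo_mul_dualSet h hA.1 ht₁ ha₂ ht₁
  have hp' := dualSet_mul_upClo_mul_dualSet h hB.1 hs₂ hb₂ hs₂
  have key₁ : ∀ w, q * s₁ * (w * b) * (q * (t₁ * a₂ * t₁)) =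
      q * (s₁ * w * t₁) * (a₂ * (b * q) * t₁) := fun w => by
    calc _ = q * s₁ * w * (b * q * (t₁ * a₂ * t₁)) := by simp only [mul_assoc]
      _ = _ := by rw [central_mul_sandwich h hbq hta]; simp only [mul_assoc]
  have key₂ : ∀ w, s₂ * b₂ * s₂ * r * (c * w) * (t₂ * r) =
      s₂ * (r * c) * b₂ * (s₂ * w * t₂) * r := fun w => by
    calc _ = s₂ * b₂ * s₂ * (r * c) * w * (t₂ * r) := by simp only [mul_assoc]
      _ = _ := by rw [sandwich_mul_central h hrc hbs]; simp only [mul_assoc]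
  have hDED : ∀ s ∈ dualSet N Z B * dualSet N Z A, ∀ e ∈ upClo N Z A * upClo N Z B,
      ∀ t ∈ dualSet N Z B * dualSet N Z A, s * e * t ∈ dualSet N Z B * dualSet N Z A := by
    rintro _ ⟨v', hv', s', hs', rfl⟩ _ ⟨x, hx, y, hy, rfl⟩ _ ⟨v, hv, s, hs, rfl⟩
    have hxyv := upClo_mul_srcSet h hA.1 hx (hsr ▸ upClo_mul_dualSet h hB hy hv)
    have := Set.mul_mem_mul hv' (dualSet_mul_upClo_mul_dualSet h hA.1 hs' hxyv hs)
    simpa only [mul_assoc] using this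
  have hE : ∀ s ∈ dualSet N Z B * dualSet N Z A,
      ∃ e ∈ upClo N Z A * upClo N Z B, s * e ∈ Z ∧ e * s ∈ Z := by
    rintro _ ⟨v, ⟨y₀, hy₀, y, hy⟩, s, ⟨x₀, hx₀, x, hx⟩, rfl⟩
    have hxy := (hx.mul h hy).2.2.2.2
    exact ⟨x * y, Set.mul_mem_mul ⟨x₀, hx₀, s, hx⟩ ⟨y₀, hy₀, v, hy⟩, hxy.2, hxy.1⟩
  obtain ⟨u, hu, v, hv, huv⟩ := sandwich_trans h hDED hE
    (x := a * b) (y := c * b) (z := c * d)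
    (Set.mul_mem_mul hq hs₁) (Set.mul_mem_mul hq hp)
    (Set.mul_mem_mul hp' hr) (Set.mul_mem_mul ht₂ hr)
    (by rw [key₁, key₁, e₁]) (by rw [key₂, key₂, e₂])
  exact ⟨u, dualSet_mul_subset h A B hu, v, dualSet_mul_subset h A B hv, huv⟩
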